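/- Fix M > 0 and let λ(ℓ) = (M²/ℓ²) √(1 − 12M²/ℓ²) / (r_-(ℓ)² − 3M r_-(ℓ)) for ℓ > 2√3 M, where r_-(ℓ) = (ℓ²/(2M))(1 − √(1 − 12M²/ℓ²)). Then dλ/dℓ = (M²/ℓ³) · 1/(r_-(ℓ)(r_-(ℓ) − 3M)) · (1 − 12M²/ℓ²)^{−1/2} · (1 − √(1 − 12M²/ℓ²)) · (1 + 4√(1 − 12M²/ℓ²)). In particular, λ is strictly increasing on (2√3 M, ∞). -/

import Mathlib

/-- Basic facts on `s = √(1 - 12M²/ℓ²)`. -/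
lemma lyap_s_facts (M : ℝ) (hM : 0 < M) (l : ℝ) (hl : 2 * Real.sqrt 3 * M < l) :
    0 < l ∧ 0 < 1 - 12 * M ^ 2 / l ^ 2 ∧ 0 < Real.sqrt (1 - 12 * M ^ 2 / l ^ 2) ∧
    Real.sqrt (1 - 12 * M ^ 2 / l ^ 2) < 1 ∧
    l ^ 2 * (1 - Real.sqrt (1 - 12 * M ^ 2 / l ^ 2) ^ 2) = 12 * M ^ 2 := by
  have h0 : 0 < 2 * Real.sqrt 3 * M := by positivity
  have hl0 : 0 < l := h0.trans hl
  have h1 : 12 * M ^ 2 < l ^ 2 := by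
    have h2 : (2 * Real.sqrt 3 * M) ^ 2 < l ^ 2 := by gcongr
    have h3 : Real.sqrt 3 ^ 2 = 3 := Real.sq_sqrt (by norm_num)
    calc 12 * M ^ 2 = (2 * Real.sqrt 3 * M) ^ 2 := by rw [mul_pow, mul_pow, h3]; ring
      _ < l ^ 2 := h2
  have hp : 0 < 1 - 12 * M ^ 2 / l ^ 2 := by
    rw [sub_pos, div_lt_one (by positivity)]; exact h1
  refine ⟨hl0, hp, Real.sqrt_pos.2 hp, ?_, ?_⟩
  · rw [Real.sqrt_lt' one_pos]
    have : 0 < 12 * M ^ 2 / l ^ 2 := by positivity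
    linarith
  · rw [Real.sq_sqrt hp.le]; field_simp; ring

/-- The denominator in terms of `s`. -/
lemma lyap_r (M l s : ℝ) (hM : 0 < M) (hs : 0 < s)
    (h : l ^ 2 * (1 - s ^ 2) = 12 * M ^ 2) :
    l ^ 2 / (2 * M) * (1 - s) = 6 * M / (1 + s) := by
  have : 1 + s ≠ 0 := by positivity
  field_simp
  linear_combination h

/-- `λ = s (1+s)³ / (216 M²)`. -/
lemma lyap_closed (M l s : ℝ) (hM : 0 < M) (hl : 0 < l) (hs : 0 < s) (hs1 : s < 1)
    (h : l ^ 2 * (1 - s ^ 2) = 12 * M ^ 2) :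
    M ^ 2 / l ^ 2 * s / ((l ^ 2 / (2 * M) * (1 - s)) ^ 2
      - 3 * M * (l ^ 2 / (2 * M) * (1 - s))) = s * (1 + s) ^ 3 / (216 * M ^ 2) := by
  rw [lyap_r M l s hM hs h]
  have h1 : 1 + s ≠ 0 := by positivity
  have h2 : 1 - s ≠ 0 := by linarith
  have e1 : M ^ 2 / l ^ 2 = (1 - s ^ 2) / 12 := by
    field_simp; linear_combination -h
  have e2 : (6 * M / (1 + s)) ^ 2 - 3 * M * (6 * M / (1 + s))
      = 18 * M ^ 2 * (1 - s) / (1 + s) ^ 2 := by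
    field_simp; ring
  rw [e1, e2]
  field_simp
  ring

/-- derivative and strict monotonicity of the squared Lyapunov
exponent `λ(ℓ)` on `(2√3 M, ∞)`. -/
theorem lyapunov_exponent_deriv (M : ℝ) (hM : 0 < M) :
    let rm : ℝ → ℝ := fun ℓ => ℓ ^ 2 / (2 * M) * (1 - Real.sqrt (1 - 12 * M ^ 2 / ℓ ^ 2))
    let lam : ℝ → ℝ := fun ℓ =>
      M ^ 2 / ℓ ^ 2 * Real.sqrt (1 - 12 * M ^ 2 / ℓ ^ 2) / ((rm ℓ) ^ 2 - 3 * M * rm ℓ)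
    (∀ ℓ : ℝ, 2 * Real.sqrt 3 * M < ℓ →
      HasDerivAt lam
        (M ^ 2 / ℓ ^ 3 * (1 / (rm ℓ * (rm ℓ - 3 * M))) *
          (Real.sqrt (1 - 12 * M ^ 2 / ℓ ^ 2))⁻¹ *
          (1 - Real.sqrt (1 - 12 * M ^ 2 / ℓ ^ 2)) *
          (1 + 4 * Real.sqrt (1 - 12 * M ^ 2 / ℓ ^ 2))) ℓ) ∧
    StrictMonoOn lam (Set.Ioi (2 * Real.sqrt 3 * M)) := by
  intro rm lam
  have key : ∀ l ∈ Set.Ioi (2 * Real.sqrt 3 * M), lam l =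
      Real.sqrt (1 - 12 * M ^ 2 / l ^ 2) * (1 + Real.sqrt (1 - 12 * M ^ 2 / l ^ 2)) ^ 3
        / (216 * M ^ 2) := by
    intro l hl
    obtain ⟨hl0, _, hs, hs1, h⟩ := lyap_s_facts M hM l hl
    exact lyap_closed M l _ hM hl0 hs hs1 h
  constructor
  · intro l hl
    obtain ⟨hl0, hp, hs, hs1, h⟩ := lyap_s_facts M hM l hl
    have hd0 : HasDerivAt (fun x : ℝ => 1 - 12 * M ^ 2 / x ^ 2) (24 * M ^ 2 / l ^ 3) l := by
      have := ((hasDerivAt_const l (12 * M ^ 2)).fun_div (hasDerivAt_pow 2 l)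
        (by positivity)).const_sub 1
      refine this.congr_deriv ?_
      field_simp
      norm_num
      ring
    have hd1 := hd0.sqrt hp.ne'
    have hd2 := (hd1.fun_mul ((hd1.const_add 1).fun_pow 3)).div_const (216 * M ^ 2)
    have hd3 := hd2.congr_of_eventuallyEq
      (Filter.eventuallyEq_of_mem (Ioi_mem_nhds hl) key)
    refine hd3.congr_deriv ?_
    simp only [rm]
    generalize Real.sqrt (1 - 12 * M ^ 2 / l ^ 2) = s at hs hs1 h ⊢
    rw [lyap_r M l s hM hs h]
    have h1 : 1 + s ≠ 0 := by positivity
    have h2 : 1 - s ≠ 0 := by linarith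
    have e2 : 6 * M / (1 + s) * (6 * M / (1 + s) - 3 * M)
        = 18 * M ^ 2 * (1 - s) / (1 + s) ^ 2 := by
      field_simp; ring
    rw [e2]
    field_simp
    norm_num
    ring
  · intro a ha b hb hab
    rw [key a ha, key b hb]
    obtain ⟨ha0, hpa, hsa, _, _⟩ := lyap_s_facts M hM a ha
    have hlt : Real.sqrt (1 - 12 * M ^ 2 / a ^ 2) < Real.sqrt (1 - 12 * M ^ 2 / b ^ 2) := by
      apply Real.sqrt_lt_sqrt hpa.le
      gcongr
    gcongr
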